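/- Let N be a positive integer, A a real symmetric N×N matrix with row sums d_i = Σ_{j=1}^N A_{ij}, 𝟙 ∈ ℝ^N the all-ones vector, J = (1/N)𝟙𝟙ᵀ, γ a real number, Σ_v = diag(σ_1²,…,σ_N²) and Σ_n = diag(s_1²,…,s_N²) diagonal matrices, Σ_z = γ²·A·Σ_v·A + Σ_n, and Q = (I_N − J)·Σ_z·(I_N − J). Then trace(Q) = γ²·Σ_{i=1}^N (Σ_{j=1}^N A_{ij}² − d_i²/N)·σ_i² + ((N−1)/N)·Σ_{i=1}^N s_i². -/

import Mathlib

open Matrix Finset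

/-- The trace of a doubly centered matrix. -/
theorem trace_centering_mul_mul_centering {n : ℕ} (hn : 0 < n) (M : Matrix (Fin n) (Fin n) ℝ) :
    ((1 - (n : ℝ)⁻¹ • Matrix.of (fun _ _ => 1)) * M *
      (1 - (n : ℝ)⁻¹ • Matrix.of (fun _ _ => 1))).trace =
      M.trace - (n : ℝ)⁻¹ * ∑ i, ∑ j, M i j := by
  have hn' : (n : ℝ) ≠ 0 := by positivity
  set E : Matrix (Fin n) (Fin n) ℝ := Matrix.of (fun _ _ => 1) with hE
  have hEE : E * E = (n : ℝ) • E := by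
    ext i j
    simp [hE, Matrix.mul_apply]
  have hidem : (1 - (n : ℝ)⁻¹ • E) * (1 - (n : ℝ)⁻¹ • E) = 1 - (n : ℝ)⁻¹ • E := by
    simp [mul_sub, sub_mul, hEE, smul_smul, hn']
  have hEM : (E * M).trace = ∑ i, ∑ j, M i j := by
    simp only [Matrix.trace, Matrix.diag_apply, Matrix.mul_apply, hE, Matrix.of_apply, one_mul]
    exact Finset.sum_comm
  rw [Matrix.trace_mul_comm, ← Matrix.mul_assoc, hidem, Matrix.sub_mul, Matrix.one_mul,
    Matrix.trace_sub, Matrix.smul_mul, Matrix.trace_smul, hEM, smul_eq_mul]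

/-- The trace of `A * diagonal v * A` for symmetric `A`. -/
theorem trace_mul_diagonal_mul_of_isSymm {n : ℕ} {A : Matrix (Fin n) (Fin n) ℝ} (hA : A.IsSymm)
    (v : Fin n → ℝ) :
    (A * Matrix.diagonal v * A).trace = ∑ i, (∑ j, A i j ^ 2) * v i := by
  simp only [Matrix.trace, Matrix.diag_apply, Matrix.mul_apply (M := A * Matrix.diagonal v),
    Matrix.mul_diagonal]
  rw [Finset.sum_comm]
  refine Finset.sum_congr rfl fun i _ => ?_
  rw [Finset.sum_mul]
  refine Finset.sum_congr rfl fun j _ => ?_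
  rw [hA.apply i j]
  ring

/-- The sum of the entries of `A * diagonal v * A` for symmetric `A`. -/
theorem sum_mul_diagonal_mul_of_isSymm {n : ℕ} {A : Matrix (Fin n) (Fin n) ℝ} (hA : A.IsSymm)
    (v : Fin n → ℝ) :
    ∑ i, ∑ j, (A * Matrix.diagonal v * A) i j = ∑ k, (∑ j, A k j) ^ 2 * v k := by
  simp only [Matrix.mul_apply (M := A * Matrix.diagonal v), Matrix.mul_diagonal]
  calc ∑ i, ∑ j, ∑ k, A i k * v k * A k j
      = ∑ k, ∑ i, ∑ j, A i k * v k * A k j := by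
        rw [Finset.sum_comm_cycle]
    _ = ∑ k, (∑ j, A k j) ^ 2 * v k := by
        refine Finset.sum_congr rfl fun k _ => ?_
        simp only [← Finset.mul_sum, ← Finset.sum_mul, hA.apply k]
        ring

/-- With `Σ_z = γ² A Σ_v A + Σ_n` (for diagonal `Σ_v = diag(σᵢ²)`, `Σ_n = diag(sᵢ²)`)
and `Q = (I - J) Σ_z (I - J)`, we have
`trace(Q) = γ² ∑ᵢ (∑ⱼ A_{ij}² - dᵢ²/N) σᵢ² + ((N-1)/N) ∑ᵢ sᵢ²`. -/
theorem stmt_14 (N : ℕ) (hN : 0 < N)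
    (A : Matrix (Fin N) (Fin N) ℝ) (hA : A.IsSymm)
    (d : Fin N → ℝ) (hd : ∀ i, d i = ∑ j, A i j)
    (J : Matrix (Fin N) (Fin N) ℝ)
    (hJ : J = (N : ℝ)⁻¹ • Matrix.of (fun _ _ => 1))
    (γ : ℝ) (σ s : Fin N → ℝ)
    (Sv Sn Sz Q : Matrix (Fin N) (Fin N) ℝ)
    (hSv : Sv = Matrix.diagonal (fun i => σ i ^ 2))
    (hSn : Sn = Matrix.diagonal (fun i => s i ^ 2))
    (hSz : Sz = γ ^ 2 • (A * Sv * A) + Sn)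
    (hQ : Q = (1 - J) * Sz * (1 - J)) :
    Q.trace = γ ^ 2 * ∑ i, ((∑ j, (A i j) ^ 2) - (d i) ^ 2 / N) * σ i ^ 2
      + ((N : ℝ) - 1) / N * ∑ i, s i ^ 2 := by
  subst hJ hSv hSn hSz hQ
  have hN' : (N : ℝ) ≠ 0 := by positivity
  have hdiag : ∑ i, ∑ j, Matrix.diagonal (fun i => s i ^ 2) i j = ∑ i, s i ^ 2 := by
    simp [Matrix.diagonal_apply]
  rw [trace_centering_mul_mul_centering hN]
  simp only [Matrix.add_apply, Matrix.smul_apply, smul_eq_mul, Finset.sum_add_distrib,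
    ← Finset.mul_sum, Matrix.trace_add, Matrix.trace_smul, Matrix.trace_diagonal, hdiag,
    trace_mul_diagonal_mul_of_isSymm hA, sum_mul_diagonal_mul_of_isSymm hA, ← hd]
  have hsplit : ∑ i, ((∑ j, A i j ^ 2) - d i ^ 2 / N) * σ i ^ 2 =
      ∑ i, (∑ j, A i j ^ 2) * σ i ^ 2 - (N : ℝ)⁻¹ * ∑ i, d i ^ 2 * σ i ^ 2 := by
    rw [Finset.mul_sum, ← Finset.sum_sub_distrib]
    exact Finset.sum_congr rfl fun i _ => by ring
  rw [hsplit]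
  field_simp
  ring
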